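/- Let p, q, r ≥ 1 and let d be a positive integer. Let H = O(p) × O(q) × O(r) act on 3-way tensors T : Fin p → Fin q → Fin r → ℝ by ((B,C,D)·T)(i,j,k) = Σ_{i',j',k'} B_{i i'} C_{j j'} D_{k k'} T(i',j',k'). Suppose f is a homogeneous multivariate polynomial of degree d in the p·q·r variables T(i,j,k) whose evaluation function is H-invariant, i.e. f((B,C,D)·T) = f(T) for all orthogonal B, C, D and all T. Then the evaluation function of f lies in the ℝ-linear span of the functions P_{(σ,τ,ρ)}, where (σ,τ,ρ) ranges over all colored Brauer diagrams on d vertices and P_{(σ,τ,ρ)}(T) = Σ ∏_{t=1}^{d} T(a(t), b(t), c(t)), the sum over all a : Fin d → Fin p with a∘σ = a, b : Fin d → Fin q with b∘τ = b, and c : Fin d → Fin r with c∘ρ = c. -/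

import Mathlib

/-- A Brauer diagram on `d` vertices: a fixed-point-free involution of `Fin d`. -/
def IsBrauerDiagram {d : ℕ} (σ : Equiv.Perm (Fin d)) : Prop :=
  (∀ x, σ (σ x) = x) ∧ ∀ x, σ x ≠ x

/-- The degree-`d` polynomial invariant associated to a colored Brauer diagram `(σ, τ, ρ)`:
`P_{(σ,τ,ρ)}(T) = Σ_{a∘σ=a, b∘τ=b, c∘ρ=c} ∏_t T (a t) (b t) (c t)`. -/
noncomputable def diagramInvariant (p q r d : ℕ) (σ τ ρ : Equiv.Perm (Fin d))
    (T : Fin p → Fin q → Fin r → ℝ) : ℝ :=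
  ∑ a ∈ Finset.univ.filter (fun a : Fin d → Fin p => a ∘ ⇑σ = a),
    ∑ b ∈ Finset.univ.filter (fun b : Fin d → Fin q => b ∘ ⇑τ = b),
      ∑ c ∈ Finset.univ.filter (fun c : Fin d → Fin r => c ∘ ⇑ρ = c),
        ∏ t : Fin d, T (a t) (b t) (c t)

/-- The action of `O(p) × O(q) × O(r)` on 3-way tensors. -/
noncomputable def actTensor (p q r : ℕ) (B : Matrix (Fin p) (Fin p) ℝ)
    (C : Matrix (Fin q) (Fin q) ℝ) (D : Matrix (Fin r) (Fin r) ℝ)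
    (T : Fin p → Fin q → Fin r → ℝ) : Fin p → Fin q → Fin r → ℝ :=
  fun i j k => ∑ i', ∑ j', ∑ k', B i i' * C j j' * D k k' * T i' j' k'

section Invariants

open Finset

theorem MvPolynomial.IsHomogeneous.exists_eval_eq_sum_prod {I : Type*} [Fintype I] [DecidableEq I]
    {d : ℕ} {f : MvPolynomial I ℝ} (hf : f.IsHomogeneous d) :
    ∃ W : (Fin d → I) → ℝ, ∀ T : I → ℝ, MvPolynomial.eval T f = ∑ x, W x * ∏ t, T (x t) := by
  have key : ∀ m : f.support, ∃ x : Fin d → I, ∀ T : I → ℝ,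
      ∏ i, T i ^ m.1 i = ∏ t, T (x t) := by
    rintro ⟨m, hm⟩
    have hdeg : m.toMultiset.card = d := by
      have h := hf (MvPolynomial.mem_support_iff.1 hm)
      rw [Finsupp.card_toMultiset]
      simp only [Finsupp.weight_apply, Pi.one_apply, smul_eq_mul, mul_one] at h
      exact h
    obtain ⟨l, hl⟩ := Quotient.exists_rep m.toMultiset
    replace hl : (l : Multiset I) = m.toMultiset := hl
    have hlen : l.length = d := by rw [← hdeg, ← hl, Multiset.coe_card]
    subst hlen
    refine ⟨l.get, fun T => ?_⟩
    have h1 : (m.toMultiset.map T).prod = ∏ i, T i ^ m i := by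
      rw [← Finsupp.prod_fintype _ _ (by simp), Finsupp.toMultiset_map, Finsupp.prod_toMultiset,
        Finsupp.prod_mapDomain_index (by simp) (by intros; rw [pow_add])]
    rw [← h1, ← hl, Multiset.map_coe, Multiset.prod_coe]
    simp [← List.prod_ofFn]
  choose x hx using key
  refine ⟨fun y => ∑ m, f.coeff m.1 * if y = x m then 1 else 0, fun T => ?_⟩
  rw [MvPolynomial.eval_eq', ← Finset.sum_coe_sort]
  simp_rw [Finset.sum_mul]
  rw [Finset.sum_comm]
  refine Finset.sum_congr rfl fun m _ => ?_
  simp [hx]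

theorem eq_zero_of_symmetric_of_sum_mul_prod_eq_zero {I : Type*} [Fintype I] [DecidableEq I]
    {d : ℕ} (U : (Fin d → I) → ℝ) (hsymm : ∀ (π : Equiv.Perm (Fin d)) x, U (x ∘ π) = U x)
    (hU : ∀ T : I → ℝ, ∑ x, U x * ∏ t, T (x t) = 0) : U = 0 := by
  let Φ : ContinuousMultilinearMap ℝ (fun _ : Fin d => I → ℝ) ℝ :=
    ∑ x, U x • (ContinuousMultilinearMap.mkPiAlgebra ℝ (Fin d) ℝ).compContinuousLinearMap
      (fun t => ContinuousLinearMap.proj (x t))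
  have hΦ (v : Fin d → I → ℝ) : Φ v = ∑ x, U x * ∏ t, v t (x t) := by
    simp [Φ]
  have hdiag : (fun T : I → ℝ => Φ fun _ => T) = 0 := by
    funext T
    simp [hΦ, hU]
  funext y
  have h := Φ.iteratedFDeriv_comp_diagonal 0 (fun t => Pi.single (y t) (1 : ℝ))
  rw [hdiag] at h
  have hval (π : Equiv.Perm (Fin d)) :
      Φ (fun t => Pi.single (y (π t)) (1 : ℝ)) = U y := by
    rw [hΦ, Finset.sum_eq_single (y ∘ π), hsymm]
    · simp
    · intro x _ hx
      obtain ⟨t, ht⟩ := Function.ne_iff.1 hx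
      rw [Finset.prod_eq_zero (mem_univ t), mul_zero]
      simpa [Pi.single_apply] using ht
    · simp
  simp only [hval, sum_const, nsmul_eq_mul] at h
  have h0 : iteratedFDeriv ℝ d (0 : (I → ℝ) → ℝ) = 0 := iteratedFDeriv_fun_zero
  rw [h0] at h
  have hcard : ((univ : Finset (Equiv.Perm (Fin d))).card : ℝ) ≠ 0 := by
    simp [Finset.card_univ, Fintype.card_perm, Nat.factorial_ne_zero]
  simpa [hcard] using h.symm

/-- A tensor of shape `ι → Fin n` is fixed by the diagonal action of the orthogonal group. -/
def IsOrthogonalInvariant {ι : Type*} [Fintype ι] [DecidableEq ι] {n : ℕ}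
    (w : (ι → Fin n) → ℝ) : Prop :=
  ∀ B ∈ Matrix.orthogonalGroup (Fin n) ℝ, ∀ a, ∑ b, (∏ t, B (b t) (a t)) * w b = w a

section Skew

variable {ι : Type*} [Fintype ι] [DecidableEq ι] {n : ℕ}

theorem sum_prod_erase_ite_mul {I : Type*} [Fintype I] [DecidableEq I] (a : ι → I) (t : ι)
    (G : (ι → I) → ℝ) :
    ∑ b, (∏ s ∈ univ.erase t, if b s = a s then 1 else 0) * G b =
      ∑ k, G (Function.update a t k) := by
  have h (k : I) : G (Function.update a t k) =
      ∑ b, if b = Function.update a t k then G b else 0 := by simp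
  simp_rw [h]
  rw [Finset.sum_comm]
  refine Finset.sum_congr rfl fun b _ => ?_
  rw [Finset.prod_ite_zero]
  simp only [Function.eq_update_iff, mem_erase, mem_univ, and_true, prod_const_one]
  by_cases hb : ∀ s, s ≠ t → b s = a s
  · rw [if_pos hb]
    simp [and_iff_left hb]
  · rw [if_neg hb]
    simp [hb]

open scoped Matrix.Norms.Operator in
theorem exp_smul_mem_orthogonalGroup (A : Matrix (Fin n) (Fin n) ℝ) (hA : A.transpose = -A)
    (θ : ℝ) : NormedSpace.exp (θ • A) ∈ Matrix.orthogonalGroup (Fin n) ℝ := by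
  rw [Matrix.mem_orthogonalGroup_iff', ← Matrix.exp_transpose, Matrix.transpose_smul,
    hA, smul_neg, ← Matrix.exp_add_of_commute _ _ (Commute.refl (θ • A)).neg_left]
  simp

open scoped Matrix.Norms.Operator in
theorem hasDerivAt_exp_smul_apply (A : Matrix (Fin n) (Fin n) ℝ) (i j : Fin n) :
    HasDerivAt (fun θ : ℝ => NormedSpace.exp (θ • A) i j) (A i j) 0 := by
  have h := hasDerivAt_exp_smul_const (𝕂 := ℝ) A 0
  simp only [zero_smul, NormedSpace.exp_zero, one_mul] at h
  exact (Matrix.entryLinearMap ℝ ℝ i j).toContinuousLinearMap.hasFDerivAt.comp_hasDerivAt 0 h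

theorem IsOrthogonalInvariant.sum_skew_update_eq_zero {w : (ι → Fin n) → ℝ}
    (hw : IsOrthogonalInvariant w) (A : Matrix (Fin n) (Fin n) ℝ) (hA : A.transpose = -A)
    (a : ι → Fin n) : ∑ t, ∑ k, A k (a t) * w (Function.update a t k) = 0 := by
  have hd : HasDerivAt (fun θ : ℝ => ∑ b, (∏ t, NormedSpace.exp (θ • A) (b t) (a t)) * w b)
      (∑ b, (∑ t, (∏ s ∈ univ.erase t, NormedSpace.exp ((0 : ℝ) • A) (b s) (a s)) •
        A (b t) (a t)) * w b) 0 :=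
    HasDerivAt.fun_sum fun b _ => HasDerivAt.mul_const
      (HasDerivAt.fun_finsetProd fun t _ => hasDerivAt_exp_smul_apply A _ _) _
  have hconst : (fun θ : ℝ => ∑ b, (∏ t, NormedSpace.exp (θ • A) (b t) (a t)) * w b) =
      fun _ => w a :=
    funext fun θ => hw _ (exp_smul_mem_orthogonalGroup A hA θ) a
  rw [hconst] at hd
  have h0 := hd.unique (hasDerivAt_const _ _)
  rw [← h0]
  simp only [zero_smul, NormedSpace.exp_zero, Matrix.one_apply, Finset.sum_mul, smul_eq_mul]
  conv_rhs => rw [Finset.sum_comm]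
  refine Finset.sum_congr rfl fun t _ => ?_
  simp_rw [mul_assoc]
  rw [sum_prod_erase_ite_mul a t fun b => A (b t) (a t) * w b]
  simp

/-- The action of the elementary matrix `E i j` of `gl n`, as a derivation, on a tensor. -/
def elementaryAction (w : (ι → Fin n) → ℝ) (i j : Fin n) (a : ι → Fin n) : ℝ :=
  ∑ t, if a t = i then w (Function.update a t j) else 0

theorem IsOrthogonalInvariant.elementaryAction_comm {w : (ι → Fin n) → ℝ}
    (hw : IsOrthogonalInvariant w) (i j : Fin n) (a : ι → Fin n) :
    elementaryAction w i j a = elementaryAction w j i a := by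
  have h := hw.sum_skew_update_eq_zero (Matrix.single j i 1 - Matrix.single i j 1)
    (by simp [Matrix.transpose_sub]) a
  simp only [Matrix.sub_apply, sub_mul, sum_sub_distrib, Matrix.single_apply, ite_mul, one_mul,
    zero_mul, ite_and, sum_ite_eq, mem_univ, if_true] at h
  simpa [elementaryAction, eq_comm] using sub_eq_zero.1 h

theorem sum_elementaryAction_mul_swap (w : (ι → Fin n) → ℝ) (a : ι → Fin n) :
    ∑ i, ∑ j, elementaryAction w i j a * elementaryAction w j i a =
      ∑ s, ∑ t, w (Function.update a s (a t)) * w (Function.update a t (a s)) := by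
  simp only [elementaryAction, sum_mul_sum, ite_mul, mul_ite, zero_mul, mul_zero]
  calc _ = ∑ i, ∑ s, ∑ t, ∑ j, if a s = i then if a t = j then
        w (Function.update a s j) * w (Function.update a t i) else 0 else 0 := by
        refine Finset.sum_congr rfl fun i _ => ?_
        rw [Finset.sum_comm]
        refine Finset.sum_congr rfl fun s _ => ?_
        rw [Finset.sum_comm]
        refine Finset.sum_congr rfl fun t _ => Finset.sum_congr rfl fun j _ => ?_
        split_ifs <;> rfl
    _ = _ := by
        rw [Finset.sum_comm]
        refine Finset.sum_congr rfl fun s _ => ?_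
        rw [Finset.sum_comm]
        refine Finset.sum_congr rfl fun t _ => ?_
        rw [Finset.sum_comm]
        simp

/-- A tensor all of whose contractions vanish has vanishing cross terms. -/
theorem sum_update_mul_update_eq_zero {w : (ι → Fin n) → ℝ} {s t : ι} (hst : s ≠ t)
    (hc : ∀ a : ι → Fin n, ∑ i, w (Function.update (Function.update a s i) t i) = 0) :
    ∑ a, w (Function.update a s (a t)) * w (Function.update a t (a s)) = 0 := by
  rw [← (Equiv.funSplitAt s (Fin n)).symm.sum_comp, Fintype.sum_prod_type, Finset.sum_comm]
  refine Finset.sum_eq_zero fun b _ => ?_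
  rcases isEmpty_or_nonempty (Fin n) with hn | ⟨⟨k⟩⟩
  · simp
  have hsplit (i : Fin n) : (Equiv.funSplitAt s (Fin n)).symm (i, b) =
      Function.update ((Equiv.funSplitAt s (Fin n)).symm (k, b)) s i := by
    funext u
    by_cases hu : u = s
    · subst hu; simp
    · simp [hu]
  set a := (Equiv.funSplitAt s (Fin n)).symm (k, b)
  simp_rw [hsplit]
  simp [hst.symm, ← Finset.mul_sum, hc]

theorem IsOrthogonalInvariant.even_card {w : (ι → Fin n) → ℝ}
    (hw : IsOrthogonalInvariant w) {a : ι → Fin n} (ha : w a ≠ 0) (i : Fin n) :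
    Even (#{t | a t = i}) := by
  let ε : Fin n → ℝ := fun k => if k = i then -1 else 1
  have hB : Matrix.diagonal ε ∈ Matrix.orthogonalGroup (Fin n) ℝ := by
    rw [Matrix.mem_orthogonalGroup_iff', Matrix.diagonal_transpose,
      Matrix.diagonal_mul_diagonal, ← Matrix.diagonal_one]
    congr 1
    funext k
    by_cases hk : k = i <;> simp [ε, hk]
  have h := hw _ hB a
  rw [Finset.sum_eq_single a] at h
  · simp only [Matrix.diagonal_apply_eq, ε, Finset.prod_ite, prod_const, one_pow, mul_one] at h
    by_contra hodd
    rw [Nat.not_even_iff_odd] at hodd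
    rw [hodd.neg_one_pow] at h
    exact ha (by linarith)
  · intro b _ hb
    obtain ⟨t, ht⟩ := Function.ne_iff.1 hb
    rw [Finset.prod_eq_zero (mem_univ t) (Matrix.diagonal_apply_ne ε ht), zero_mul]
  · simp

theorem IsOrthogonalInvariant.eq_zero_of_traceless [Nonempty ι] {w : (ι → Fin n) → ℝ}
    (hw : IsOrthogonalInvariant w)
    (hc : ∀ s t, s ≠ t → ∀ a : ι → Fin n,
      ∑ i, w (Function.update (Function.update a s i) t i) = 0) : w = 0 := by
  have hupper : ∑ a, ∑ i, ∑ j, elementaryAction w i j a ^ 2 =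
      Fintype.card ι * ∑ a, w a ^ 2 := by
    calc _ = ∑ a, ∑ s, ∑ t, w (Function.update a s (a t)) * w (Function.update a t (a s)) := by
          refine Finset.sum_congr rfl fun a _ => ?_
          rw [← sum_elementaryAction_mul_swap]
          refine Finset.sum_congr rfl fun i _ => Finset.sum_congr rfl fun j _ => ?_
          rw [sq, hw.elementaryAction_comm j i]
      _ = ∑ s, ∑ t, ∑ a, w (Function.update a s (a t)) * w (Function.update a t (a s)) := by
          rw [Finset.sum_comm]
          exact Finset.sum_congr rfl fun s _ => Finset.sum_comm
      _ = ∑ s : ι, ∑ a, w a ^ 2 := by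
          refine Finset.sum_congr rfl fun s _ => ?_
          rw [Finset.sum_eq_single s]
          · simp [sq]
          · intro t _ hts
            exact sum_update_mul_update_eq_zero hts.symm (hc s t hts.symm)
          · simp
      _ = _ := by simp
  have hlower (a : ι → Fin n) : 2 * Fintype.card ι * w a ^ 2 ≤
      ∑ i, ∑ j, elementaryAction w i j a ^ 2 := by
    have hdiag (i : Fin n) : 2 * (#{t | a t = i} : ℝ) * w a ^ 2 ≤
        ∑ j, elementaryAction w i j a ^ 2 := by
      refine le_trans ?_ (Finset.single_le_sum (f := fun j => elementaryAction w i j a ^ 2)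
        (fun j _ => sq_nonneg _) (mem_univ i))
      have hM : elementaryAction w i i a = #{t | a t = i} * w a := by
        rw [elementaryAction, ← Finset.sum_filter, ← nsmul_eq_mul]
        refine Finset.sum_eq_card_nsmul fun t ht => ?_
        rw [← (mem_filter.1 ht).2, Function.update_eq_self]
      rw [hM, mul_pow]
      by_cases ha : w a = 0
      · simp [ha]
      obtain ⟨m, hm⟩ := hw.even_card ha i
      refine mul_le_mul_of_nonneg_right ?_ (sq_nonneg _)
      have h2 : 2 * #{t | a t = i} ≤ #{t | a t = i} ^ 2 := by
        rw [hm]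
        rcases m with _ | m
        · simp
        · nlinarith
      exact_mod_cast h2
    have hcard : (Fintype.card ι : ℝ) = ∑ i, (#{t | a t = i} : ℝ) := by
      rw [← Finset.card_univ, Finset.card_eq_sum_card_fiberwise (f := a) (t := univ) (by simp)]
      push_cast
      rfl
    rw [hcard, Finset.mul_sum, Finset.sum_mul]
    exact Finset.sum_le_sum fun i _ => hdiag i
  have hle : 2 * Fintype.card ι * ∑ a, w a ^ 2 ≤ Fintype.card ι * ∑ a, w a ^ 2 := by
    rw [← hupper, Finset.mul_sum]
    exact Finset.sum_le_sum fun a _ => hlower a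
  have hpos : (0 : ℝ) < Fintype.card ι := by exact_mod_cast Fintype.card_pos
  have hsum : ∑ a, w a ^ 2 = 0 :=
    le_antisymm (by nlinarith) (Finset.sum_nonneg fun a _ => sq_nonneg _)
  funext a
  have := (Finset.sum_eq_zero_iff_of_nonneg fun a _ => sq_nonneg (w a)).1 hsum a (mem_univ a)
  simpa using this

end Skew

section Contraction

variable {ι : Type*} {s t : ι}


/-- The points other than `s` and `t`. -/
abbrev Away (s t : ι) : Type _ := {u : ι // u ≠ s ∧ u ≠ t}

/-- Restrict a function to the points other than `s` and `t`. -/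
def restrictPair {I : Type*} (s t : ι) (a : ι → I) : Away s t → I := fun u => a u

variable [DecidableEq ι]

/-- Extend a function defined away from `s` and `t` by the value `i` at `s` and `t`. -/
def extendPair {I : Type*} (a : Away s t → I) (i : I) (u : ι) : I :=
  if h : u ≠ s ∧ u ≠ t then a ⟨u, h⟩ else i

@[simp]
theorem extendPair_left {I : Type*} (a : Away s t → I) (i : I) :
    extendPair a i s = i := by
  simp [extendPair]

@[simp]
theorem extendPair_right {I : Type*} (a : Away s t → I) (i : I) :
    extendPair a i t = i := by
  simp [extendPair]

@[simp]
theorem extendPair_coe {I : Type*} (a : Away s t → I) (i : I)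
    (u : Away s t) : extendPair a i u = a u := by
  simp [extendPair, u.2.1, u.2.2]

theorem extendPair_restrict {I : Type*} (a : ι → I) (hst : a s = a t) :
    extendPair (restrictPair s t a) (a s) = a := by
  funext u
  by_cases hs : u = s
  · subst hs; simp
  by_cases ht : u = t
  · subst ht; simp [hst]
  simp [extendPair, restrictPair, hs, ht]

theorem extendPair_eq_update {I : Type*} (a : ι → I) (i : I) :
    extendPair (restrictPair s t a) i =
      Function.update (Function.update a s i) t i := by
  funext u
  by_cases ht : u = t
  · subst ht; simp
  by_cases hs : u = s
  · subst hs; simp [ht]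
  simp [extendPair, restrictPair, hs, ht]

@[simp]
theorem restrictPair_extendPair {I : Type*} (a : Away s t → I) (i : I) :
    restrictPair s t (extendPair a i) = a :=
  funext fun u => extendPair_coe a i u

theorem comp_perm_eq_iff_of_pair {I : Type*} {σ : Equiv.Perm ι}
    {σ' : Equiv.Perm (Away s t)} (hs : σ s = t) (ht : σ t = s)
    (hσ : ∀ u : Away s t, σ u = σ' u) (a : ι → I) :
    a ∘ σ = a ↔ a s = a t ∧
      restrictPair s t a ∘ σ' = restrictPair s t a := by
  constructor
  · intro h
    refine ⟨?_, funext fun u => ?_⟩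
    · rw [← ht]; exact congrFun h t
    · simp only [Function.comp_apply, restrictPair, ← hσ]
      exact congrFun h u
  · rintro ⟨hst, h⟩
    funext u
    by_cases hus : u = s
    · subst hus; simp [hs, hst]
    by_cases hut : u = t
    · subst hut; simp [ht, hst]
    have := congrFun h ⟨u, hus, hut⟩
    simpa only [Function.comp_apply, restrictPair, ← hσ] using this

variable [Fintype ι]

theorem sum_ite_eq_sum_extendPair {I : Type*} [Fintype I] [DecidableEq I] (G : (ι → I) → ℝ) :
    ∑ a, (if a s = a t then G a else 0) =
      ∑ a' : Away s t → I, ∑ i, G (extendPair a' i) := by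
  rw [← Finset.sum_filter, ← Fintype.sum_prod_type']
  refine Finset.sum_nbij' (fun a => (restrictPair s t a, a s)) (fun x => extendPair x.1 x.2)
    ?_ ?_ ?_ ?_ ?_
  · simp
  · simp
  · intro a ha
    exact extendPair_restrict a (mem_filter.1 ha).2
  · rintro ⟨a', i⟩ _
    simp
  · intro a ha
    rw [extendPair_restrict a (mem_filter.1 ha).2]

theorem prod_eq_mul_mul_prod_subtype_ne {M : Type*} [CommMonoid M] (hst : s ≠ t) (F : ι → M) :
    ∏ u, F u = F s * F t * ∏ u : Away s t, F u := by
  rw [← Finset.mul_prod_erase univ F (mem_univ s),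
    ← Finset.mul_prod_erase (univ.erase s) F (by simp [hst.symm] : t ∈ univ.erase s), mul_assoc]
  congr 2
  exact Finset.prod_subtype _ (by simp [and_comm]) F

theorem sum_orthogonal_mul {n : ℕ} {B : Matrix (Fin n) (Fin n) ℝ}
    (hB : B ∈ Matrix.orthogonalGroup (Fin n) ℝ) (i j : Fin n) :
    ∑ k, B i k * B j k = if i = j then 1 else 0 := by
  have h := congrFun (congrFun ((Matrix.mem_orthogonalGroup_iff (Fin n) ℝ).1 hB) i) j
  simpa [Matrix.mul_apply, Matrix.one_apply] using h

theorem sum_orthogonal_mul' {n : ℕ} {B : Matrix (Fin n) (Fin n) ℝ}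
    (hB : B ∈ Matrix.orthogonalGroup (Fin n) ℝ) (i j : Fin n) :
    ∑ k, B k i * B k j = if i = j then 1 else 0 := by
  have h := congrFun (congrFun ((Matrix.mem_orthogonalGroup_iff' (Fin n) ℝ).1 hB) i) j
  simpa [Matrix.mul_apply, Matrix.one_apply] using h

theorem IsOrthogonalInvariant.contract {n : ℕ} {w : (ι → Fin n) → ℝ}
    (hw : IsOrthogonalInvariant w) (hst : s ≠ t) :
    IsOrthogonalInvariant fun a' : Away s t → Fin n =>
      ∑ i, w (extendPair a' i) := by
  intro B hB a'
  have hleft := sum_ite_eq_sum_extendPair (s := s) (t := t) fun b : ι → Fin n =>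
    (∏ u : Away s t, B (b u) (a' u)) * w b
  simp only [extendPair_coe, ← Finset.mul_sum] at hleft
  simp only
  rw [← hleft]
  calc _ = ∑ b, ∑ k, (∏ u, B (b u) (extendPair a' k u)) * w b := by
        refine Finset.sum_congr rfl fun b _ => ?_
        rw [← Finset.sum_mul]
        simp only [prod_eq_mul_mul_prod_subtype_ne hst, extendPair_left, extendPair_right,
          extendPair_coe, ← Finset.sum_mul, sum_orthogonal_mul hB]
        simp
    _ = _ := by
        rw [Finset.sum_comm]
        exact Finset.sum_congr rfl fun k _ => hw B hB _

theorem isOrthogonalInvariant_brauer {n : ℕ} {σ : Equiv.Perm ι} (hinv : ∀ x, σ (σ x) = x)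
    (hfix : ∀ x, σ x ≠ x) :
    IsOrthogonalInvariant fun a : ι → Fin n => if a ∘ σ = a then (1 : ℝ) else 0 := by
  induction hN : Fintype.card ι using Nat.strong_induction_on generalizing ι with
  | _ N ih =>
  intro B hB a
  rcases isEmpty_or_nonempty ι with hι | ⟨⟨s⟩⟩
  · simp [Subsingleton.elim _ a]
  obtain ⟨t, hs⟩ : ∃ t, σ s = t := ⟨_, rfl⟩
  have ht : σ t = s := by rw [← hs, hinv]
  have hst : s ≠ t := by rw [← hs]; exact (hfix s).symm
  let σ' : Equiv.Perm (Away s t) := σ.subtypePerm fun u => by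
    rw [← not_iff_not]
    simp only [not_and_or, not_not]
    constructor
    · rintro (h | h)
      · right; rw [← hinv u, h, hs]
      · left; rw [← hinv u, h, ht]
    · rintro (h | h)
      · right; rw [h, hs]
      · left; rw [h, ht]
  have hσ : ∀ u : Away s t, σ u = σ' u := fun u => rfl
  have hcard : Fintype.card (Away s t) < N := by
    rw [← hN]
    exact Fintype.card_subtype_lt (x := s) (by simp)
  have key := ih _ hcard (σ := σ') (fun x => Subtype.ext (hinv x))
    (fun x h => hfix x (congrArg Subtype.val h)) rfl B hB (restrictPair s t a)
  simp only [mul_ite, mul_one, mul_zero, comp_perm_eq_iff_of_pair hs ht hσ,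
    ite_and] at key ⊢
  rw [sum_ite_eq_sum_extendPair fun b : ι → Fin n =>
    if restrictPair s t b ∘ σ' = restrictPair s t b then ∏ u, B (b u) (a u) else 0]
  simp only [prod_eq_mul_mul_prod_subtype_ne hst, extendPair_left, extendPair_right,
    extendPair_coe, restrictPair_extendPair]
  rw [← key]
  calc _ = ∑ b : Away s t → Fin n, (if a s = a t then 1 else 0) *
        if b ∘ σ' = b then ∏ u : Away s t, B (b u) (a u) else 0 := by
        refine Finset.sum_congr rfl fun b _ => ?_
        rw [← sum_orthogonal_mul' hB, Finset.sum_mul]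
        refine Finset.sum_congr rfl fun i _ => ?_
        split_ifs <;> simp
    _ = _ := by
        rw [← Finset.mul_sum, ite_mul, one_mul, zero_mul]
        rfl

theorem IsOrthogonalInvariant.eq_zero_of_sum_brauer_eq_zero {n : ℕ} {w : (ι → Fin n) → ℝ}
    (hw : IsOrthogonalInvariant w)
    (horth : ∀ σ : Equiv.Perm ι, (∀ x, σ (σ x) = x) → (∀ x, σ x ≠ x) →
      ∑ a, (if a ∘ σ = a then w a else 0) = 0) : w = 0 := by
  induction hN : Fintype.card ι using Nat.strong_induction_on generalizing ι with
  | _ N ih =>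
  rcases isEmpty_or_nonempty ι with hι | hι
  · funext a
    have h := horth 1 (fun x => hι.elim x) (fun x => hι.elim x)
    simpa [Subsingleton.elim _ a] using h
  refine hw.eq_zero_of_traceless fun s t hst a => ?_
  have hcard : Fintype.card (Away s t) < N := by
    rw [← hN]
    exact Fintype.card_subtype_lt (x := s) (by simp)
  have hzero := ih _ hcard (hw.contract hst) (fun σ' hinv hfix => ?_) rfl
  · simp_rw [← extendPair_eq_update]
    exact congrFun hzero (restrictPair s t a)
  let σ : Equiv.Perm ι := Equiv.Perm.ofSubtype σ' * Equiv.swap s t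
  have hfixed {u : ι} (hu : ¬(u ≠ s ∧ u ≠ t)) : Equiv.Perm.ofSubtype σ' u = u :=
    Equiv.Perm.ofSubtype_apply_of_not_mem σ' hu
  have hs : σ s = t := by simp [σ, hfixed]
  have ht : σ t = s := by simp [σ, hfixed]
  have hσ (u : Away s t) : σ u = σ' u := by
    simp [σ, Equiv.swap_apply_of_ne_of_ne u.2.1 u.2.2]
  have hcases (P : ι → Prop) (h1 : P s) (h2 : P t)
      (h3 : ∀ u : Away s t, P u) (x : ι) : P x := by
    by_cases hxs : x = s
    · exact hxs ▸ h1
    by_cases hxt : x = t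
    · exact hxt ▸ h2
    exact h3 ⟨x, hxs, hxt⟩
  have h := horth σ
    (hcases _ (by rw [hs, ht]) (by rw [ht, hs]) fun u => by rw [hσ, hσ, hinv])
    (hcases _ (by rw [hs]; exact hst.symm) (by rw [ht]; exact hst)
      fun u => by rw [hσ]; exact fun h => hfix u (Subtype.ext h))
  simp only [comp_perm_eq_iff_of_pair hs ht hσ, ite_and] at h
  rw [sum_ite_eq_sum_extendPair fun a : ι → Fin n =>
    if restrictPair s t a ∘ σ' = restrictPair s t a then w a else 0] at h
  simp only [restrictPair_extendPair] at h
  refine Eq.trans ?_ h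
  refine Finset.sum_congr rfl fun a' _ => ?_
  split_ifs <;> simp

end Contraction

/-- The tensors fixed by the diagonal action of the orthogonal group, as a subspace. -/
def orthogonalInvariants (ι : Type*) [Fintype ι] [DecidableEq ι] (n : ℕ) :
    Submodule ℝ ((ι → Fin n) → ℝ) where
  carrier := {w | IsOrthogonalInvariant w}
  add_mem' := fun {v w} hv hw B hB a => by
    simp only [Pi.add_apply, mul_add, sum_add_distrib, hv B hB a, hw B hB a]
  zero_mem' := fun B _ a => by simp
  smul_mem' := fun c w hw B hB a => by
    simp only [Pi.smul_apply, smul_eq_mul, mul_left_comm _ c, ← mul_sum, hw B hB a]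

/-- First fundamental theorem for the orthogonal group, in tensor form. -/
theorem IsOrthogonalInvariant.mem_span_brauer {ι : Type*} [Fintype ι] [DecidableEq ι] {n : ℕ}
    {w : (ι → Fin n) → ℝ} (hw : IsOrthogonalInvariant w) :
    w ∈ Submodule.span ℝ (Set.range
      fun (σ : {σ : Equiv.Perm ι // (∀ x, σ (σ x) = x) ∧ ∀ x, σ x ≠ x}) (a : ι → Fin n) =>
        if a ∘ σ.1 = a then (1 : ℝ) else 0) := by
  classical
  set δ := fun (σ : {σ : Equiv.Perm ι // (∀ x, σ (σ x) = x) ∧ ∀ x, σ x ≠ x})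
    (a : ι → Fin n) => if a ∘ σ.1 = a then (1 : ℝ) else 0 with hδ
  obtain ⟨y, hy, z, hz, hyz⟩ := (Submodule.span ℝ (Set.range fun σ =>
    (WithLp.toLp 2 (δ σ) : EuclideanSpace ℝ (ι → Fin n)))).exists_add_mem_mem_orthogonal
      (WithLp.toLp 2 w)
  obtain ⟨c, rfl⟩ := (Submodule.mem_span_range_iff_exists_fun ℝ).1 hy
  have hwz : w = ∑ σ, c σ • δ σ + z.ofLp := by
    have := congrArg WithLp.ofLp hyz
    simpa using this
  have hu : ∑ σ, c σ • δ σ ∈ orthogonalInvariants ι n :=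
    Submodule.sum_mem _ fun σ _ => Submodule.smul_mem _ _
      (isOrthogonalInvariant_brauer σ.2.1 σ.2.2)
  have hzinv : IsOrthogonalInvariant z.ofLp := by
    have : z.ofLp = w - ∑ σ, c σ • δ σ := by rw [hwz]; simp
    rw [this]
    exact (orthogonalInvariants ι n).sub_mem hw hu
  have hz0 : z.ofLp = 0 := by
    refine hzinv.eq_zero_of_sum_brauer_eq_zero fun σ hinv hfix => ?_
    have h := hz _ (Submodule.subset_span ⟨⟨σ, hinv, hfix⟩, rfl⟩)
    simpa [PiLp.inner_apply, hδ] using h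
  rw [hwz, hz0, add_zero]
  exact Submodule.sum_mem _ fun σ _ => Submodule.smul_mem _ _ (Submodule.subset_span ⟨σ, rfl⟩)

/-- Coefficients of the elements of a span can be chosen linearly. -/
theorem exists_linear_coeff_of_mem_span {S X : Type*} [Fintype S] [Fintype X] [DecidableEq X]
    (δ : S → X → ℝ) :
    ∃ c : S → X → ℝ, ∀ w ∈ Submodule.span ℝ (Set.range δ), ∀ x,
      w x = ∑ s, (∑ y, c s y * w y) * δ s x := by
  let L : (S → ℝ) →ₗ[ℝ] (X → ℝ) := Fintype.linearCombination ℝ δ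
  obtain ⟨g, hg⟩ := L.rangeRestrict.exists_rightInverse_of_surjective L.range_rangeRestrict
  obtain ⟨g', hg'⟩ := g.exists_extend
  refine ⟨fun s y => g' (fun z => if y = z then 1 else 0) s, fun w hw x => ?_⟩
  rw [← Fintype.range_linearCombination ℝ] at hw
  have h1 : L (g ⟨w, hw⟩) = w := congrArg Subtype.val (LinearMap.congr_fun hg ⟨w, hw⟩)
  have h2 : g ⟨w, hw⟩ = g' w := (LinearMap.congr_fun hg' ⟨w, hw⟩).symm
  have h3 (s : S) : g' w s = ∑ y, g' (fun z => if y = z then 1 else 0) s * w y := by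
    conv_lhs => rw [LinearMap.pi_apply_eq_sum_univ g' w]
    simp [mul_comm]
  simp_rw [← h3, ← h2]
  conv_lhs => rw [← h1]
  simp [L, Fintype.linearCombination_apply]

theorem sum_prod_mul_eq_of_invariant {I : Type*} [Fintype I] [DecidableEq I] {d : ℕ}
    {W : (Fin d → I) → ℝ} (hsymm : ∀ (π : Equiv.Perm (Fin d)) x, W (x ∘ π) = W x)
    (h : I → I → ℝ)
    (hinv : ∀ T : I → ℝ, ∑ x, W x * ∏ t, ∑ u, h (x t) u * T u = ∑ x, W x * ∏ t, T (x t))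
    (y : Fin d → I) : ∑ x, (∏ t, h (x t) (y t)) * W x = W y := by
  rw [← sub_eq_zero]
  refine congrFun (eq_zero_of_symmetric_of_sum_mul_prod_eq_zero
    (fun y => ∑ x, (∏ t, h (x t) (y t)) * W x - W y) (fun π y => ?_) fun T => ?_) y
  · rw [hsymm, ← (Equiv.arrowCongr π.symm (Equiv.refl I)).sum_comp]
    congr 1
    refine Finset.sum_congr rfl fun x _ => ?_
    have hx : Equiv.arrowCongr π.symm (Equiv.refl I) x = x ∘ π := rfl
    rw [hx, hsymm, ← Equiv.prod_comp π (fun t => h (x t) (y t))]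
    rfl
  · simp_rw [sub_mul, Finset.sum_sub_distrib, sub_eq_zero, ← hinv, Finset.prod_univ_sum,
      Fintype.piFinset_univ, Finset.sum_mul, Finset.mul_sum, Finset.prod_mul_distrib]
    rw [Finset.sum_comm]
    exact Finset.sum_congr rfl fun x _ => Finset.sum_congr rfl fun y _ => by ring

theorem MvPolynomial.IsHomogeneous.exists_symmetric_eval_eq_sum_prod {I : Type*} [Fintype I]
    [DecidableEq I] {d : ℕ} {f : MvPolynomial I ℝ} (hf : f.IsHomogeneous d) :
    ∃ W : (Fin d → I) → ℝ, (∀ (π : Equiv.Perm (Fin d)) x, W (x ∘ π) = W x) ∧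
      ∀ T : I → ℝ, MvPolynomial.eval T f = ∑ x, W x * ∏ t, T (x t) := by
  obtain ⟨W₀, hW₀⟩ := hf.exists_eval_eq_sum_prod
  have hd : (d.factorial : ℝ) ≠ 0 := by exact_mod_cast d.factorial_ne_zero
  refine ⟨fun x => (d.factorial : ℝ)⁻¹ * ∑ π : Equiv.Perm (Fin d), W₀ (x ∘ π),
    fun π x => ?_, fun T => ?_⟩
  · refine congrArg _ ?_
    exact Equiv.sum_comp (Equiv.mulLeft π) fun π' : Equiv.Perm (Fin d) => W₀ (x ∘ π')
  · have hperm (π : Equiv.Perm (Fin d)) :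
        ∑ x : Fin d → I, W₀ (x ∘ π) * ∏ t, T (x t) = MvPolynomial.eval T f := by
      rw [hW₀]
      conv_rhs => rw [← (Equiv.arrowCongr π.symm (Equiv.refl I)).sum_comp]
      refine Finset.sum_congr rfl fun x _ => ?_
      have hx : Equiv.arrowCongr π.symm (Equiv.refl I) x = x ∘ π := rfl
      rw [hx, ← Equiv.prod_comp π fun t => T (x t)]
      rfl
    simp_rw [mul_assoc, ← Finset.mul_sum, Finset.sum_mul]
    rw [Finset.sum_comm]
    simp_rw [hperm]
    simp [Finset.card_univ, Fintype.card_perm, hd]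

theorem sum_arrow_prod_prod {κ I J K M : Type*} [Fintype κ] [DecidableEq κ] [Fintype I] [Fintype J]
    [Fintype K] [AddCommMonoid M] (G : (κ → I × J × K) → M) :
    ∑ x, G x = ∑ a : κ → I, ∑ b : κ → J, ∑ c : κ → K, G fun t => (a t, b t, c t) := by
  simp_rw [← Fintype.sum_prod_type']
  exact Fintype.sum_equiv
    ⟨fun x => (fun t => (x t).1, fun t => (x t).2.1, fun t => (x t).2.2),
      fun y t => (y.1 t, y.2.1 t, y.2.2 t), fun _ => rfl, fun _ => rfl⟩ _ _ fun _ => rfl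

theorem prod_one_apply {κ : Type*} [Fintype κ] [DecidableEq κ] {n : ℕ} (b' b : κ → Fin n) :
    ∏ t, (1 : Matrix (Fin n) (Fin n) ℝ) (b' t) (b t) = if b' = b then 1 else 0 := by
  simp_rw [Matrix.one_apply]
  rw [Finset.prod_ite_zero]
  simp [funext_iff]

theorem IsOrthogonalInvariant.exists_linear_coeff (d n : ℕ)
    [Fintype {σ : Equiv.Perm (Fin d) // IsBrauerDiagram σ}] :
    ∃ c : {σ : Equiv.Perm (Fin d) // IsBrauerDiagram σ} → (Fin d → Fin n) → ℝ,
      ∀ w : (Fin d → Fin n) → ℝ, IsOrthogonalInvariant w → ∀ a,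
        w a = ∑ σ, (∑ a', c σ a' * w a') * if a ∘ σ.1 = a then 1 else 0 := by
  obtain ⟨c, hc⟩ := exists_linear_coeff_of_mem_span
    fun (σ : {σ : Equiv.Perm (Fin d) // IsBrauerDiagram σ}) (a : Fin d → Fin n) =>
      if a ∘ σ.1 = a then (1 : ℝ) else 0
  exact ⟨c, fun w hw a => hc w hw.mem_span_brauer a⟩

theorem diagramInvariant_eq_sum_ite (p q r d : ℕ) (σ τ ρ : Equiv.Perm (Fin d))
    (T : Fin p → Fin q → Fin r → ℝ) :
    diagramInvariant p q r d σ τ ρ T = ∑ a : Fin d → Fin p, ∑ b : Fin d → Fin q,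
      ∑ c : Fin d → Fin r, (if a ∘ σ = a then 1 else 0) * (if b ∘ τ = b then 1 else 0) *
        (if c ∘ ρ = c then 1 else 0) * ∏ t, T (a t) (b t) (c t) := by
  simp only [diagramInvariant, Finset.sum_filter, ite_mul, one_mul, zero_mul, mul_ite, mul_zero,
    mul_one]
  refine Finset.sum_congr rfl fun a _ => ?_
  by_cases ha : a ∘ σ = a
  · simp only [ha, if_true]
    refine Finset.sum_congr rfl fun b _ => ?_
    by_cases hb : b ∘ τ = b <;> simp [hb]
  · simp [ha]

theorem sum_mul_eq_sum_sum_mul {X S : Type*} [Fintype X] [Fintype S] (A F : X → ℝ)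
    {G : S → X → ℝ} {e : S → ℝ} (h : ∀ x, F x = ∑ s, G s x * e s) :
    ∑ x, A x * F x = ∑ s, (∑ x, A x * G s x) * e s := by
  simp_rw [h, Finset.mul_sum, Finset.sum_mul, mul_assoc]
  exact Finset.sum_comm

theorem sum_comm_triple {X Y Z S M : Type*} [Fintype X] [Fintype Y] [Fintype Z] [Fintype S]
    [AddCommMonoid M] (G : X → Y → Z → S → M) :
    ∑ a, ∑ b, ∑ c, ∑ s, G a b c s = ∑ s, ∑ a, ∑ b, ∑ c, G a b c s := by
  calc _ = ∑ a, ∑ b, ∑ s, ∑ c, G a b c s :=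
        Finset.sum_congr rfl fun a _ => Finset.sum_congr rfl fun b _ => Finset.sum_comm
    _ = ∑ a, ∑ s, ∑ b, ∑ c, G a b c s := Finset.sum_congr rfl fun a _ => Finset.sum_comm
    _ = _ := Finset.sum_comm

end Invariants

theorem stmt_7 (p q r : ℕ) (hp : 1 ≤ p) (hq : 1 ≤ q) (hr : 1 ≤ r) (d : ℕ) (hd : 0 < d)
    (f : MvPolynomial (Fin p × Fin q × Fin r) ℝ) (hf : f.IsHomogeneous d)
    (hinv : ∀ B ∈ Matrix.orthogonalGroup (Fin p) ℝ, ∀ C ∈ Matrix.orthogonalGroup (Fin q) ℝ,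
      ∀ D ∈ Matrix.orthogonalGroup (Fin r) ℝ, ∀ T : Fin p → Fin q → Fin r → ℝ,
        MvPolynomial.eval (fun v => actTensor p q r B C D T v.1 v.2.1 v.2.2) f =
          MvPolynomial.eval (fun v => T v.1 v.2.1 v.2.2) f) :
    (fun T : Fin p → Fin q → Fin r → ℝ => MvPolynomial.eval (fun v => T v.1 v.2.1 v.2.2) f) ∈
      Submodule.span ℝ
        {g : (Fin p → Fin q → Fin r → ℝ) → ℝ |
          ∃ σ τ ρ : Equiv.Perm (Fin d),
            IsBrauerDiagram σ ∧ IsBrauerDiagram τ ∧ IsBrauerDiagram ρ ∧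
              g = diagramInvariant p q r d σ τ ρ} := by
  classical
  obtain ⟨W, hsymm, hW⟩ := hf.exists_symmetric_eval_eq_sum_prod
  let V (a : Fin d → Fin p) (b : Fin d → Fin q) (c : Fin d → Fin r) : ℝ :=
    W fun t => (a t, b t, c t)
  have hV : ∀ B ∈ Matrix.orthogonalGroup (Fin p) ℝ, ∀ C ∈ Matrix.orthogonalGroup (Fin q) ℝ,
      ∀ D ∈ Matrix.orthogonalGroup (Fin r) ℝ, ∀ a b c, ∑ a', ∑ b', ∑ c',
        ((∏ t, B (a' t) (a t)) * (∏ t, C (b' t) (b t)) * ∏ t, D (c' t) (c t)) * V a' b' c' =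
          V a b c := by
    intro B hB C hC D hD a b c
    have h := sum_prod_mul_eq_of_invariant hsymm
      (fun x y => B x.1 y.1 * C x.2.1 y.2.1 * D x.2.2 y.2.2) (fun T => ?_)
      fun t => (a t, b t, c t)
    · rw [sum_arrow_prod_prod] at h
      simpa only [Finset.prod_mul_distrib] using h
    · have hT := hinv B hB C hC D hD fun i j k => T (i, j, k)
      rw [hW, hW] at hT
      simpa only [actTensor, Fintype.sum_prod_type] using hT
  obtain ⟨α, hα⟩ := IsOrthogonalInvariant.exists_linear_coeff d p
  obtain ⟨β, hβ⟩ := IsOrthogonalInvariant.exists_linear_coeff d q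
  obtain ⟨γ, hγ⟩ := IsOrthogonalInvariant.exists_linear_coeff d r
  have hVa (b c) : IsOrthogonalInvariant fun a => V a b c := fun B hB a => by
    simpa [prod_one_apply] using hV B hB 1 (one_mem _) 1 (one_mem _) a b c
  have hVb (a c) : IsOrthogonalInvariant fun b => V a b c := fun C hC b => by
    simpa [prod_one_apply] using hV 1 (one_mem _) C hC 1 (one_mem _) a b c
  have hVc (a b) : IsOrthogonalInvariant fun c => V a b c := fun D hD c => by
    simpa [prod_one_apply] using hV 1 (one_mem _) 1 (one_mem _) D hD a b c
  let κ (σ τ ρ : {σ : Equiv.Perm (Fin d) // IsBrauerDiagram σ}) : ℝ :=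
    ∑ a, α σ a * ∑ b, β τ b * ∑ c, γ ρ c * V a b c
  have hexp (a b c) : V a b c = ∑ σ, ∑ τ, ∑ ρ, κ σ τ ρ * ((if a ∘ σ.1 = a then 1 else 0) *
      (if b ∘ τ.1 = b then 1 else 0) * (if c ∘ ρ.1 = c then 1 else 0)) := by
    rw [hα _ (hVa b c) a]
    refine Finset.sum_congr rfl fun σ _ => ?_
    rw [sum_mul_eq_sum_sum_mul _ _ fun a' => hβ _ (hVb a' c) b, Finset.sum_mul]
    refine Finset.sum_congr rfl fun τ _ => ?_
    rw [sum_mul_eq_sum_sum_mul _ _ fun a' =>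
      sum_mul_eq_sum_sum_mul _ _ fun b' => hγ _ (hVc a' b') c, Finset.sum_mul, Finset.sum_mul]
    exact Finset.sum_congr rfl fun ρ _ => by ring
  have hsum : (fun T : Fin p → Fin q → Fin r → ℝ =>
      MvPolynomial.eval (fun v => T v.1 v.2.1 v.2.2) f) =
      ∑ σ : {σ : Equiv.Perm (Fin d) // IsBrauerDiagram σ},
        ∑ τ : {σ : Equiv.Perm (Fin d) // IsBrauerDiagram σ},
          ∑ ρ : {σ : Equiv.Perm (Fin d) // IsBrauerDiagram σ},
            κ σ τ ρ • diagramInvariant p q r d σ τ ρ := by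
    funext T
    simp only [hW, sum_arrow_prod_prod, Finset.sum_apply, Pi.smul_apply, smul_eq_mul,
      diagramInvariant_eq_sum_ite]
    calc _ = ∑ a, ∑ b, ∑ c, V a b c * ∏ t, T (a t) (b t) (c t) := rfl
      _ = _ := by
        simp_rw [hexp, Finset.sum_mul, Finset.mul_sum]
        rw [sum_comm_triple]
        refine Finset.sum_congr rfl fun σ _ => ?_
        rw [sum_comm_triple]
        refine Finset.sum_congr rfl fun τ _ => ?_
        rw [sum_comm_triple]
        refine Finset.sum_congr rfl fun ρ _ => ?_
        simp_rw [mul_assoc]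
  rw [hsum]
  exact Submodule.sum_mem _ fun σ _ => Submodule.sum_mem _ fun τ _ => Submodule.sum_mem _
    fun ρ _ => Submodule.smul_mem _ _ (Submodule.subset_span
      ⟨σ, τ, ρ, σ.2, τ.2, ρ.2, rfl⟩)
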